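/- Let X be a countable simplicial complex which is homogeneous and such that every finite simplicial complex is isomorphic to an induced subcomplex of X. Then X is a Rado complex; in particular, every countable simplicial complex is isomorphic to an induced subcomplex of X. -/

import Mathlib

/-- An (abstract) simplicial complex with vertices drawn from `ℕ`:
a set of nonempty finite subsets of `ℕ` (the simplexes) closed under
passing to nonempty subsets.  The vertex set `V(X)` is the set of `v`
with `{v}` a simplex. -/
structure SComplex where
  faces : Set (Finset ℕ)
  nonempty_of_mem : ∀ s ∈ faces, s.Nonempty
  down_closed : ∀ s ∈ faces, ∀ t ⊆ s, t.Nonempty → t ∈ faces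

namespace SComplex

/-- The vertex set of a simplicial complex. -/
def vertexSet (X : SComplex) : Set ℕ := {v | {v} ∈ X.faces}

/-- The subcomplex of `X` induced on a set `U` of vertices. -/
def induced (X : SComplex) (U : Set ℕ) : SComplex where
  faces := {s | s ∈ X.faces ∧ (↑s : Set ℕ) ⊆ U}
  nonempty_of_mem := fun s hs => X.nonempty_of_mem s hs.1
  down_closed := fun s hs t hts ht =>
    ⟨X.down_closed s hs.1 t hts ht,
     fun x hx => hs.2 (Finset.mem_coe.mpr (hts (Finset.mem_coe.mp hx)))⟩

/-- The link of a vertex `v`: all simplexes `σ` with `v ∉ σ` and `σ ∪ {v}` a simplex. -/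
def link (X : SComplex) (v : ℕ) : SComplex where
  faces := {s | s ∈ X.faces ∧ v ∉ s ∧ insert v s ∈ X.faces}
  nonempty_of_mem := fun s hs => X.nonempty_of_mem s hs.1
  down_closed := fun s hs t hts ht =>
    ⟨X.down_closed s hs.1 t hts ht,
     fun hv => hs.2.1 (hts hv),
     X.down_closed _ hs.2.2 _ (Finset.insert_subset_insert v hts)
       (Finset.insert_nonempty v t)⟩

/-- `IsIso X Y f` : the map `f` is an isomorphism of simplicial complexes from `X` to `Y`,
i.e. a bijection of the vertex sets which induces a bijection between the sets of simplexes. -/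
def IsIso (X Y : SComplex) (f : ℕ → ℕ) : Prop :=
  Set.BijOn f X.vertexSet Y.vertexSet ∧
    ∀ s : Finset ℕ, (↑s : Set ℕ) ⊆ X.vertexSet → (s ∈ X.faces ↔ s.image f ∈ Y.faces)

/-- Two simplicial complexes are isomorphic. -/
def Isomorphic (X Y : SComplex) : Prop := ∃ f, IsIso X Y f

/-- `X` is universal: every countable simplicial complex is isomorphic to an induced
subcomplex of `X`. -/
def Universal (X : SComplex) : Prop :=
  ∀ Y : SComplex, Y.vertexSet.Countable →
    ∃ U ⊆ X.vertexSet, Isomorphic Y (X.induced U)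

/-- `X` is homogeneous: every isomorphism between finite induced subcomplexes of `X`
extends to an isomorphism of `X` onto itself. -/
def Homogeneous (X : SComplex) : Prop :=
  ∀ U U' : Set ℕ, U.Finite → U'.Finite → U ⊆ X.vertexSet → U' ⊆ X.vertexSet →
    ∀ f : ℕ → ℕ, IsIso (X.induced U) (X.induced U') f →
      ∃ F : ℕ → ℕ, IsIso X X F ∧ Set.EqOn F f U

/-- A Rado complex: a countable simplicial complex which is universal and homogeneous. -/
def IsRado (X : SComplex) : Prop :=
  X.vertexSet.Countable ∧ Universal X ∧ Homogeneous X

/-- The ampleness condition: for every finite `U ⊆ V(X)` and every subcomplex `A` of the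
induced complex `X_U` there is a vertex `v ∈ V(X) - U` with `Lk_X(v) ∩ X_U = A`. -/
def AmpleProp (X : SComplex) : Prop :=
  ∀ U : Set ℕ, U.Finite → U ⊆ X.vertexSet →
    ∀ A : SComplex, A.faces ⊆ (X.induced U).faces →
      ∃ v ∈ X.vertexSet \ U, (X.link v).faces ∩ (X.induced U).faces = A.faces

/-- An ample complex: a countable simplicial complex satisfying the ampleness condition. -/
def IsAmple (X : SComplex) : Prop := X.vertexSet.Countable ∧ AmpleProp X

/-- `L'` is an induced subcomplex of `L`. -/
def IsInduced (L' L : SComplex) : Prop :=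
  L'.faces ⊆ L.faces ∧ ∀ s ∈ L.faces, (↑s : Set ℕ) ⊆ L'.vertexSet → s ∈ L'.faces

end SComplex

namespace SComplex

theorem coe_subset_vertexSet {X : SComplex} {s : Finset ℕ} (hs : s ∈ X.faces) :
    (↑s : Set ℕ) ⊆ X.vertexSet := fun v hv =>
  X.down_closed s hs {v} (by simpa using hv) (Finset.singleton_nonempty v)

theorem vertexSet_induced {X : SComplex} {U : Set ℕ} (hU : U ⊆ X.vertexSet) :
    (X.induced U).vertexSet = U := by
  ext v
  simp only [vertexSet, induced, Set.mem_ofPred_eq, Finset.coe_singleton,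
    Set.singleton_subset_iff]
  exact ⟨fun h => h.2, fun h => ⟨hU h, h⟩⟩

theorem induced_vertexSet (X : SComplex) : X.induced X.vertexSet = X := by
  obtain ⟨F, h₁, h₂⟩ := X
  simp only [induced, mk.injEq]
  ext s
  exact ⟨fun h => h.1, fun h => ⟨h, coe_subset_vertexSet (X := ⟨F, h₁, h₂⟩) h⟩⟩

/-- `f` embeds the part of `Y` lying over `U` into `X` as an induced subcomplex. -/
def IsEmbOn (Y X : SComplex) (U : Set ℕ) (f : ℕ → ℕ) : Prop :=
  Set.InjOn f U ∧ ∀ s : Finset ℕ, (↑s : Set ℕ) ⊆ U → (s ∈ Y.faces ↔ s.image f ∈ X.faces)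

variable {X Y Z : SComplex} {U V W : Set ℕ} {f g : ℕ → ℕ}

theorem IsEmbOn.image_subset (h : IsEmbOn Y X U f) (hU : U ⊆ Y.vertexSet) :
    f '' U ⊆ X.vertexSet := by
  rintro _ ⟨v, hv, rfl⟩
  simpa [vertexSet] using (h.2 {v} (by simpa using hv)).1 (hU hv)

theorem IsEmbOn.mono (h : IsEmbOn Y X V f) (hUV : U ⊆ V) : IsEmbOn Y X U f :=
  ⟨h.1.mono hUV, fun s hs => h.2 s (hs.trans hUV)⟩

theorem IsEmbOn.congr (h : IsEmbOn Y X U f) (hfg : Set.EqOn f g U) : IsEmbOn Y X U g :=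
  ⟨h.1.congr hfg, fun s hs => by
    rw [h.2 s hs, Finset.image_congr fun v hv => hfg (hs hv)]⟩

theorem IsEmbOn.comp (hg : IsEmbOn X Z (f '' U) g) (hf : IsEmbOn Y X U f) :
    IsEmbOn Y Z U (g ∘ f) :=
  ⟨hg.1.comp hf.1 (Set.mapsTo_image f U), fun s hs => by
    rw [hf.2 s hs, hg.2 _ (by rw [Finset.coe_image]; exact Set.image_mono hs),
      Finset.image_image]⟩

theorem IsEmbOn.of_leftInvOn (hf : IsEmbOn Y X U f) (hg : Set.LeftInvOn g f U) :
    IsEmbOn X Y (f '' U) g := by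
  refine ⟨?_, fun s hs => ?_⟩
  · rintro _ ⟨v, hv, rfl⟩ _ ⟨w, hw, rfl⟩ h
    rw [hg hv, hg hw] at h
    rw [h]
  obtain ⟨t, ht, rfl⟩ := Finset.subset_set_image_iff.1 hs
  have himg : t.image (g ∘ f) = t :=
    (Finset.image_congr fun v hv => hg (ht hv)).trans Finset.image_id
  rw [← hf.2 t ht, Finset.image_image, himg]

theorem IsIso.isEmbOn (h : IsIso Y X f) : IsEmbOn Y X Y.vertexSet f :=
  ⟨h.1.injOn, h.2⟩

theorem IsIso.isEmbOn_induced (hU : U ⊆ Y.vertexSet)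
    (h : IsIso (Y.induced U) (X.induced W) f) : IsEmbOn Y X U f := by
  have hV := vertexSet_induced hU
  refine ⟨hV ▸ h.1.injOn, fun s hs => ?_⟩
  have h₂ := h.2 s (hV.symm ▸ hs)
  refine ⟨fun hsY => (h₂.1 ⟨hsY, hs⟩).1, fun hsX => (h₂.2 ⟨hsX, ?_⟩).1⟩
  intro w hw
  obtain ⟨v, hv, rfl⟩ := Finset.mem_image.1 (Finset.mem_coe.1 hw)
  have := h.1.mapsTo (hV.symm ▸ hs hv)
  simpa using this.2

theorem IsEmbOn.isIso_induced (h : IsEmbOn Y X U f) (hU : U ⊆ Y.vertexSet) :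
    IsIso (Y.induced U) (X.induced (f '' U)) f := by
  rw [IsIso, vertexSet_induced hU, vertexSet_induced (h.image_subset hU)]
  refine ⟨h.1.bijOn_image, fun s hs => ?_⟩
  have hs' : (↑(s.image f) : Set ℕ) ⊆ f '' U := by
    rw [Finset.coe_image]; exact Set.image_mono hs
  exact ⟨fun h' => ⟨(h.2 s hs).1 h'.1, hs'⟩, fun h' => ⟨(h.2 s hs).2 h'.1, hs⟩⟩

theorem Homogeneous.exists_isEmbOn_extension (hhom : X.Homogeneous)
    (hfin : ∀ L : SComplex, L.vertexSet.Finite →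
      ∃ U ⊆ X.vertexSet, Isomorphic L (X.induced U))
    (hV : V.Finite) (hVY : V ⊆ Y.vertexSet) (hUV : U ⊆ V) (hf : IsEmbOn Y X U f) :
    ∃ g, IsEmbOn Y X V g ∧ Set.EqOn g f U := by
  obtain ⟨W, -, h, hiso⟩ := hfin (Y.induced V) (by rwa [vertexSet_induced hVY])
  have hV' := hiso.isEmbOn_induced hVY
  have hh := hV'.mono hUV
  have hUY := hUV.trans hVY
  have hUfin := hV.subset hUV
  have hinv : Set.LeftInvOn (Function.invFunOn h U) h U := hh.1.leftInvOn_invFunOn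
  have himg : Function.invFunOn h U '' (h '' U) = U := hinv.image_image
  have hφ : IsEmbOn X X (h '' U) (f ∘ Function.invFunOn h U) :=
    IsEmbOn.comp (himg.symm ▸ hf) (hh.of_leftInvOn hinv)
  have hA := hh.image_subset hUY
  obtain ⟨F, hF, hFφ⟩ := hhom _ _ (hUfin.image h) ((hUfin.image h).image _) hA
    (hφ.image_subset hA) _ (hφ.isIso_induced hA)
  refine ⟨F ∘ h, (hF.isEmbOn.mono (hV'.image_subset hVY)).comp hV', fun u hu => ?_⟩
  rw [Function.comp_apply, hFφ (Set.mem_image_of_mem h hu), Function.comp_apply, hinv hu]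

theorem Homogeneous.universal (hhom : X.Homogeneous)
    (hfin : ∀ L : SComplex, L.vertexSet.Finite →
      ∃ U ⊆ X.vertexSet, Isomorphic L (X.induced U)) :
    X.Universal := by
  intro Y _
  let V : ℕ → Set ℕ := fun n => Y.vertexSet ∩ Set.Iio n
  have hVY n : V n ⊆ Y.vertexSet := Set.inter_subset_left
  have hVmono : Monotone V := fun m n hmn =>
    Set.inter_subset_inter_right _ (Set.Iio_subset_Iio hmn)
  have hVfin n : (V n).Finite := (Set.finite_Iio n).inter_of_right _
  have hzero : ∃ f, IsEmbOn Y X (V 0) f := by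
    obtain ⟨W, -, f, hf⟩ := hfin (Y.induced (V 0))
      (by rw [vertexSet_induced (hVY 0)]; exact hVfin 0)
    exact ⟨f, hf.isEmbOn_induced (hVY 0)⟩
  have hsucc (n : ℕ) (f : {f // IsEmbOn Y X (V n) f}) :
      ∃ g : {g // IsEmbOn Y X (V (n + 1)) g}, Set.EqOn g.1 f.1 (V n) := by
    obtain ⟨g, hg, hgf⟩ := hhom.exists_isEmbOn_extension hfin (hVfin (n + 1)) (hVY (n + 1))
      (hVmono n.le_succ) f.2
    exact ⟨⟨g, hg⟩, hgf⟩
  choose ext hext using hsucc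
  obtain ⟨f₀, hf₀⟩ := hzero
  let F : ∀ n, {f // IsEmbOn Y X (V n) f} := fun n => Nat.rec ⟨f₀, hf₀⟩ ext n
  have hF {m n : ℕ} (hmn : m ≤ n) : Set.EqOn (F n).1 (F m).1 (V m) := by
    induction n, hmn using Nat.le_induction with
    | base => exact Set.eqOn_refl _ _
    | succ n hmn ih => exact ((hext n (F n)).mono (hVmono hmn)).trans ih
  let G : ℕ → ℕ := fun v => (F (v + 1)).1 v
  have hG n : IsEmbOn Y X (V n) G := (F n).2.congr fun v hv =>
    hF (Nat.succ_le_of_lt hv.2) ⟨hv.1, Nat.lt_succ_self v⟩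
  have hGY : IsEmbOn Y X Y.vertexSet G := by
    refine ⟨fun v hv w hw h => ?_, fun s hs => (hG (s.sup id + 1)).2 s fun v hv =>
      ⟨hs hv, Nat.lt_succ_of_le (Finset.le_sup (f := id) hv)⟩⟩
    exact (hG (max v w + 1)).1 ⟨hv, by simp⟩ ⟨hw, by simp⟩ h
  have hiso := hGY.isIso_induced subset_rfl
  rw [induced_vertexSet] at hiso
  exact ⟨_, hGY.image_subset subset_rfl, G, hiso⟩

end SComplex

/-- A countable homogeneous simplicial complex in which every finite
simplicial complex embeds as an induced subcomplex is a Rado complex; in particular it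
is universal. -/
theorem rado_of_homogeneous_finitely_universal (X : SComplex)
    (hc : X.vertexSet.Countable) (hhom : X.Homogeneous)
    (hfin : ∀ L : SComplex, L.vertexSet.Finite →
      ∃ U ⊆ X.vertexSet, SComplex.Isomorphic L (X.induced U)) :
    X.IsRado := by
  exact ⟨hc, hhom.universal hfin, hhom⟩
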